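/- Let α be a symbol of the graph group G_F, let p be an α-peak, and let a, r ∈ G satisfy p ≤ r ≤ ar. Then there exists a' ∈ G with p ≤ a'p, #_α(p⁻¹a'p) = #_α(r⁻¹ar), and |a'| ≤ |a|. -/

import Mathlib

open Pointwise

namespace GraphGroupPaper

/-- The set of commutator relators: `gᵢ` and `gⱼ` commute for every pair of distinct
`i, j` with `{i,j} ∉ F`. -/
def Rels (k : ℕ) (F : Set (Sym2 (Fin k))) : Set (FreeGroup (Fin k)) :=
  {w | ∃ i j : Fin k, i ≠ j ∧ s(i, j) ∉ F ∧
      w = FreeGroup.of i * FreeGroup.of j * (FreeGroup.of i)⁻¹ * (FreeGroup.of j)⁻¹}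

/-- The graph group `G_F` with generators `g₁, …, g_k` and relations `gᵢgⱼ = gⱼgᵢ`
for all distinct `i, j` with `{i,j} ∉ F`. -/
abbrev Grp (k : ℕ) (F : Set (Sym2 (Fin k))) := PresentedGroup (Rels k F)

/-- The generator `gᵢ` of the graph group. -/
def gen (k : ℕ) (F : Set (Sym2 (Fin k))) (i : Fin k) : Grp k F :=
  PresentedGroup.of i

/-- The group element corresponding to a symbol: `(i, true)` stands for `gᵢ`,
`(i, false)` stands for `gᵢ⁻¹`. -/
def sym (k : ℕ) (F : Set (Sym2 (Fin k))) (α : Fin k × Bool) : Grp k F :=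
  if α.2 then gen k F α.1 else (gen k F α.1)⁻¹

/-- The product of the word `l` of symbols, as an element of the graph group. -/
def wordProd (k : ℕ) (F : Set (Sym2 (Fin k))) (l : List (Fin k × Bool)) : Grp k F :=
  (l.map (sym k F)).prod

/-- `|x|` : the length of a shortest word in the symbols representing `x`. -/
noncomputable def len {k : ℕ} {F : Set (Sym2 (Fin k))} (x : Grp k F) : ℕ :=
  sInf {n | ∃ l : List (Fin k × Bool), wordProd k F l = x ∧ l.length = n}

/-- The partial order on `G_F`:  `x ≤ y` iff `|y| = |x| + |x⁻¹y|`. -/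
def le {k : ℕ} {F : Set (Sym2 (Fin k))} (x y : Grp k F) : Prop :=
  len y = len x + len (x⁻¹ * y)

/-- `m` is the meet `x ∧ y` (greatest lower bound w.r.t. `le`). -/
def IsMeet {k : ℕ} {F : Set (Sym2 (Fin k))} (x y m : Grp k F) : Prop :=
  le m x ∧ le m y ∧ ∀ w, le w x → le w y → le w m

/-- `j` is the (finite) join `x ∨ y` (least upper bound w.r.t. `le`);
`x ∨ y` is finite iff such a `j` exists. -/
def IsJoin {k : ℕ} {F : Set (Sym2 (Fin k))} (x y j : Grp k F) : Prop :=
  le x j ∧ le y j ∧ ∀ w, le x w → le y w → le j w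

/-- `j` is the (finite) join of the set `S`. -/
def IsJoinSet {k : ℕ} {F : Set (Sym2 (Fin k))} (S : Set (Grp k F)) (j : Grp k F) : Prop :=
  (∀ s ∈ S, le s j) ∧ ∀ w, (∀ s ∈ S, le s w) → le j w

/-- `y` is a segment of `a` if `a = x·y·z` for some `x, z`. -/
def Segment {k : ℕ} {F : Set (Sym2 (Fin k))} (y a : Grp k F) : Prop :=
  ∃ x z, a = x * y * z ∧ len a = len x + len y + len z

/-- The left-invariant metric `dist(x,y) = |x⁻¹y|`. -/
noncomputable def dist {k : ℕ} {F : Set (Sym2 (Fin k))} (x y : Grp k F) : ℕ :=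
  len (x⁻¹ * y)

/-- A nonempty set `L` is convex if `x, z ∈ L` and `dist(x,y) + dist(y,z) = dist(x,z)`
imply `y ∈ L`. -/
def ConvexSet {k : ℕ} {F : Set (Sym2 (Fin k))} (L : Set (Grp k F)) : Prop :=
  L.Nonempty ∧ ∀ x z y : Grp k F, x ∈ L → z ∈ L →
    dist x y + dist y z = dist x z → y ∈ L

/-- An ideal: nonempty, downward closed, and closed under finite joins. -/
def IdealSet {k : ℕ} {F : Set (Sym2 (Fin k))} (I : Set (Grp k F)) : Prop :=
  I.Nonempty ∧ (∀ x ∈ I, ∀ y, le y x → y ∈ I) ∧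
    (∀ x ∈ I, ∀ y ∈ I, ∀ j, IsJoin x y j → j ∈ I)

/-- `H` is closed if both `H` and `H⁻¹` are ideals. -/
def ClosedSet {k : ℕ} {F : Set (Sym2 (Fin k))} (H : Set (Grp k F)) : Prop :=
  IdealSet H ∧ IdealSet H⁻¹

/-- `m` is a minimal element of `S` w.r.t. `le`. -/
def MinimalIn {k : ℕ} {F : Set (Sym2 (Fin k))} (S : Set (Grp k F)) (m : Grp k F) : Prop :=
  m ∈ S ∧ ∀ x ∈ S, le x m → x = m

/-- `l` is a reduced (i.e. shortest) word representing `x`. -/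
def MinWord {k : ℕ} {F : Set (Sym2 (Fin k))} (x : Grp k F) (l : List (Fin k × Bool)) : Prop :=
  wordProd k F l = x ∧ l.length = len x

open Classical in
/-- `#_α(x)`: the number of occurrences of the symbol `α` (not counting `α⁻¹`)
in a reduced word representing `x`. -/
noncomputable def symCount {k : ℕ} {F : Set (Sym2 (Fin k))} (α : Fin k × Bool)
    (x : Grp k F) : ℕ :=
  if h : ∃ l, MinWord x l then h.choose.count α else 0

/-- The symbol `α` occurs in `x`. -/
def Occurs {k : ℕ} {F : Set (Sym2 (Fin k))} (α : Fin k × Bool) (x : Grp k F) : Prop :=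
  0 < symCount α x

/-- `α` is a maximal symbol of `x`, i.e. `xα⁻¹ ≤ x`. -/
def MaxSym {k : ℕ} {F : Set (Sym2 (Fin k))} (α : Fin k × Bool) (x : Grp k F) : Prop :=
  le (x * (sym k F α)⁻¹) x

/-- A peak: an element with precisely one maximal symbol. -/
def IsPeak {k : ℕ} {F : Set (Sym2 (Fin k))} (p : Grp k F) : Prop :=
  ∃! α : Fin k × Bool, MaxSym α p

/-- An `α`-peak: a peak whose unique maximal symbol is `α`. -/
def AlphaPeak {k : ℕ} {F : Set (Sym2 (Fin k))} (α : Fin k × Bool) (p : Grp k F) : Prop :=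
  MaxSym α p ∧ ∀ β, MaxSym β p → β = α

/-- The set of generator indices occurring in `b`. -/
def Support {k : ℕ} {F : Set (Sym2 (Fin k))} (b : Grp k F) : Set (Fin k) :=
  {i | Occurs (i, true) b ∨ Occurs (i, false) b}

/-- `b` is connected: the generators occurring in `b` induce a connected subgraph of
the graph `([k], F)`. -/
def Conn {k : ℕ} {F : Set (Sym2 (Fin k))} (b : Grp k F) : Prop :=
  (SimpleGraph.induce (Support b) (SimpleGraph.fromEdgeSet F)).Connected

/-- `b` is cyclically reduced: `b ∧ b⁻¹ = 1`. -/
def CycRed {k : ℕ} {F : Set (Sym2 (Fin k))} (b : Grp k F) : Prop :=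
  IsMeet b b⁻¹ 1

section Heaps

variable {k : ℕ} {F : Set (Sym2 (Fin k))}

/-- The symbol inverse to `β`. -/
def bar (β : Fin k × Bool) : Fin k × Bool := (β.1, !β.2)

@[simp] lemma bar_bar (β : Fin k × Bool) : bar (bar β) = β := by simp [bar]

@[simp] lemma bar_fst (β : Fin k × Bool) : (bar β).1 = β.1 := rfl

lemma sym_bar (β : Fin k × Bool) : sym k F (bar β) = (sym k F β)⁻¹ := by
  rcases β with ⟨i, _ | _⟩ <;> simp [bar, sym]

/-- The generator `b` is an endpoint of `e`, where `e` is a pair in `F` or a diagonal pair. -/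
def Inc (F : Set (Sym2 (Fin k))) (b : Fin k) (e : Sym2 (Fin k)) : Prop :=
  b ∈ e ∧ (e ∈ F ∨ e.IsDiag)

lemma inc_diag {b i : Fin k} : Inc F b s(i, i) ↔ b = i := by
  simp [Inc]

lemma inc_diag_self (b : Fin k) : Inc F b s(b, b) := inc_diag.2 rfl

lemma not_inc_of_notMem {b c : Fin k} (hbc : b ≠ c) (h : s(b, c) ∉ F) {e : Sym2 (Fin k)}
    (hb : Inc F b e) : ¬ Inc F c e := by
  intro hc
  have he : e = s(b, c) := ((Sym2.mem_and_mem_iff hbc).1 ⟨hb.1, hc.1⟩)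
  subst he
  rcases hb.2 with h' | h'
  · exact h h'
  · exact hbc (by simpa using h')

lemma commute_sym {β γ : Fin k × Bool} (h : ∀ e, Inc F β.1 e → ¬ Inc F γ.1 e) :
    Commute (sym k F β) (sym k F γ) := by
  have hne : β.1 ≠ γ.1 := fun hbc =>
    h _ (inc_diag_self _) (inc_diag.2 hbc.symm)
  have hF : s(β.1, γ.1) ∉ F := fun hF =>
    h s(β.1, γ.1) ⟨by simp, Or.inl hF⟩ ⟨by simp, Or.inl hF⟩
  have hg : Commute (gen k F β.1) (gen k F γ.1) := by
    have h1 : (PresentedGroup.mk (Rels k F)) (FreeGroup.of β.1 * FreeGroup.of γ.1 *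
        (FreeGroup.of β.1)⁻¹ * (FreeGroup.of γ.1)⁻¹) = 1 :=
      PresentedGroup.one_of_mem ⟨β.1, γ.1, hne, hF, rfl⟩
    simp only [map_mul, map_inv] at h1
    exact (mul_inv_eq_iff_eq_mul.1 (mul_inv_eq_one.1 h1))
  unfold sym
  split_ifs
  · exact hg
  · exact hg.inv_right
  · exact hg.inv_left
  · exact hg.inv_inv

/-- A family of words recording, for each pair of dependent generators, the letters with index
in that pair. The heads of the lists are the last letters. -/
abbrev Proj (k : ℕ) := Sym2 (Fin k) → List (Fin k × Bool)

/-- `β` is the last letter in every component in which it takes part. -/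
def Hd (F : Set (Sym2 (Fin k))) (β : Fin k × Bool) (f : Proj k) : Prop :=
  ∀ e, Inc F β.1 e → (f e).head? = some β

open Classical in
/-- Append `β`. -/
noncomputable def push (F : Set (Sym2 (Fin k))) (β : Fin k × Bool) (f : Proj k) : Proj k :=
  fun e => if Inc F β.1 e then β :: f e else f e

open Classical in
/-- Remove the last letter in every component in which the generator `b` takes part. -/
noncomputable def pop (F : Set (Sym2 (Fin k))) (b : Fin k) (f : Proj k) : Proj k :=
  fun e => if Inc F b e then (f e).tail else f e

open Classical in
/-- Multiply by `β` on the right, cancelling a final `β⁻¹` if there is one. -/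
noncomputable def act (F : Set (Sym2 (Fin k))) (β : Fin k × Bool) (f : Proj k) : Proj k :=
  if Hd F (bar β) f then pop F β.1 f else push F β f

lemma hd_push_self (β : Fin k × Bool) (f : Proj k) : Hd F β (push F β f) := by
  intro e he
  simp [push, he]

lemma pop_push (β : Fin k × Bool) (f : Proj k) : pop F β.1 (push F β f) = f := by
  funext e
  by_cases he : Inc F β.1 e <;> simp [push, pop, he]

lemma push_pop {β : Fin k × Bool} {f : Proj k} (h : Hd F β f) :
    push F β (pop F β.1 f) = f := by
  funext e
  by_cases he : Inc F β.1 e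
  · simpa [push, pop, he] using List.cons_head?_tail (h e he)
  · simp [push, pop, he]

lemma hd_congr {β : Fin k × Bool} {f g : Proj k} (h : ∀ e, Inc F β.1 e → f e = g e) :
    Hd F β f ↔ Hd F β g := by
  refine forall₂_congr fun e he => ?_
  rw [h e he]

lemma hd_push_of_disjoint {β γ : Fin k × Bool} {f : Proj k}
    (h : ∀ e, Inc F β.1 e → ¬ Inc F γ.1 e) : Hd F β (push F γ f) ↔ Hd F β f :=
  hd_congr fun e he => by simp [push, h e he]

lemma hd_pop_of_disjoint {β : Fin k × Bool} {c : Fin k} {f : Proj k}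
    (h : ∀ e, Inc F β.1 e → ¬ Inc F c e) : Hd F β (pop F c f) ↔ Hd F β f :=
  hd_congr fun e he => by simp [pop, h e he]

lemma hd_push {β γ : Fin k × Bool} {f : Proj k} (h : Hd F β (push F γ f)) :
    β = γ ∨ (∀ e, Inc F β.1 e → ¬ Inc F γ.1 e) ∧ Hd F β f := by
  by_cases hd : ∀ e, Inc F β.1 e → ¬ Inc F γ.1 e
  · exact Or.inr ⟨hd, (hd_push_of_disjoint hd).1 h⟩
  · push Not at hd
    obtain ⟨e, hb, hc⟩ := hd
    have := h e hb
    simp only [push, hc, if_true, List.head?_cons, Option.some.injEq] at this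
    exact Or.inl this.symm

lemma push_comm {β γ : Fin k × Bool} (h : ∀ e, Inc F β.1 e → ¬ Inc F γ.1 e) (f : Proj k) :
    push F β (push F γ f) = push F γ (push F β f) := by
  funext e
  by_cases hb : Inc F β.1 e
  · simp [push, hb, h e hb]
  · simp [push, hb]

lemma act_comm {β γ : Fin k × Bool} (h : ∀ e, Inc F β.1 e → ¬ Inc F γ.1 e) (f : Proj k) :
    act F β (act F γ f) = act F γ (act F β f) := by
  have h' : ∀ e, Inc F γ.1 e → ¬ Inc F β.1 e := fun e hc hb => h e hb hc
  have h1 : Hd F (bar β) (act F γ f) ↔ Hd F (bar β) f :=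
    hd_congr fun e he => by
      have := h e he
      unfold act
      split_ifs <;> simp [push, pop, this]
  have h2 : Hd F (bar γ) (act F β f) ↔ Hd F (bar γ) f :=
    hd_congr fun e he => by
      have := h' e he
      unfold act
      split_ifs <;> simp [push, pop, this]
  funext e
  by_cases hb : Inc F β.1 e
  · have hc := h e hb
    by_cases p1 : Hd F (bar β) f
    · rw [act, if_pos (h1.2 p1)]
      conv_rhs => rw [act]
      rw [act, act, if_pos p1]
      split_ifs <;> simp [push, pop, hb, hc]
    · rw [act, if_neg (h1.not.2 p1)]
      conv_rhs => rw [act]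
      rw [act, act, if_neg p1]
      split_ifs <;> simp [push, pop, hb, hc]
  · by_cases p2 : Hd F (bar γ) f
    · conv_rhs => rw [act, if_pos (h2.2 p2)]
      rw [act, act, act, if_pos p2]
      split_ifs <;> simp [push, pop, hb]
    · conv_rhs => rw [act, if_neg (h2.not.2 p2)]
      rw [act, act, act, if_neg p2]
      split_ifs <;> simp [push, pop, hb]

/-- `f` is obtained by writing down the letters of a word for `x` without cancellation. -/
inductive Rep : Proj k → Grp k F → Prop
  | nil : Rep (fun _ => []) 1
  | cons {f : Proj k} {x : Grp k F} (γ : Fin k × Bool) (h : Rep f x) (hγ : ¬ Hd F (bar γ) f) :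
      Rep (push F γ f) (x * sym k F γ)

lemma Rep.of_push {g : Proj k} {x : Grp k F} (h : Rep g x) {β : Fin k × Bool} {f : Proj k}
    (hg : g = push F β f) : Rep f (x * (sym k F β)⁻¹) ∧ ¬ Hd F (bar β) f := by
  induction h generalizing f with
  | nil =>
    have := congrFun hg s(β.1, β.1)
    simp [push, inc_diag_self] at this
  | @cons g y γ hy hγ ih =>
    have hβ : Hd F β (push F γ g) := hg ▸ hd_push_self β f
    rcases hd_push hβ with rfl | ⟨hd, hβ'⟩
    · have : g = f := by rw [← pop_push (F := F) β g, hg, pop_push]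
      subst this
      simpa using ⟨hy, hγ⟩
    · obtain ⟨h1, h2⟩ := ih (push_pop hβ').symm
      have hf : f = push F γ (pop F β.1 g) := by
        rw [← pop_push (F := F) β f, ← hg]
        nth_rw 1 [← push_pop hβ']
        rw [← push_comm hd, pop_push]
      have hd' : ∀ e, Inc F (bar γ).1 e → ¬ Inc F β.1 e := fun e hc hb => hd e hb hc
      have h3 : ¬ Hd F (bar γ) (pop F β.1 g) := by rwa [hd_pop_of_disjoint hd']
      have hc : y * sym k F γ * (sym k F β)⁻¹ = y * (sym k F β)⁻¹ * sym k F γ := by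
        rw [mul_assoc, mul_assoc, (commute_sym hd).symm.inv_right.eq]
      refine ⟨?_, ?_⟩
      · rw [hf, hc]
        exact h1.cons γ h3
      · rw [hf]
        exact (hd_push_of_disjoint (β := bar β) hd).not.2 h2

lemma Rep.act {f : Proj k} {x : Grp k F} (h : Rep f x) (β : Fin k × Bool) :
    Rep (act F β f) (x * sym k F β) := by
  unfold GraphGroupPaper.act
  split_ifs with hβ
  · have := (h.of_push (push_pop hβ).symm).1
    rwa [sym_bar, inv_inv] at this
  · exact h.cons β hβ

lemma Rep.act_bar_act {f : Proj k} {x : Grp k F} (h : Rep f x) (β : Fin k × Bool) :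
    GraphGroupPaper.act F (bar β) (GraphGroupPaper.act F β f) = f := by
  by_cases hβ : Hd F (bar β) f
  · have h2 := (h.of_push (push_pop hβ).symm).2
    have : GraphGroupPaper.act F β f = pop F β.1 f := if_pos hβ
    rw [this]
    exact (if_neg h2).trans (push_pop hβ)
  · have : GraphGroupPaper.act F β f = push F β f := if_neg hβ
    rw [this]
    refine (if_pos ?_).trans (pop_push β f)
    rw [bar_bar]
    exact hd_push_self β f

/-- Families of projections of reduced words. -/
abbrev RedProj (k : ℕ) (F : Set (Sym2 (Fin k))) := {f : Proj k // ∃ x : Grp k F, Rep f x}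

/-- Right multiplication by `β` as a permutation. -/
noncomputable def actPerm (F : Set (Sym2 (Fin k))) (β : Fin k × Bool) :
    Equiv.Perm (RedProj k F) where
  toFun f := ⟨act F β f.1, f.2.elim fun _ h => ⟨_, h.act β⟩⟩
  invFun f := ⟨act F (bar β) f.1, f.2.elim fun _ h => ⟨_, h.act (bar β)⟩⟩
  left_inv f := Subtype.ext (f.2.elim fun _ h => h.act_bar_act β)
  right_inv f := Subtype.ext (f.2.elim fun _ h => by simpa using h.act_bar_act (bar β))

/-- The action of the graph group on projections of reduced words, `x` acting as right
multiplication by `x⁻¹`. -/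
noncomputable def actHom (k : ℕ) (F : Set (Sym2 (Fin k))) :
    Grp k F →* Equiv.Perm (RedProj k F) :=
  PresentedGroup.toGroup (f := fun i => actPerm F (i, false)) (by
    rintro _ ⟨i, j, hij, hF, rfl⟩
    simp only [map_mul, map_inv, FreeGroup.lift_apply_of]
    rw [mul_inv_eq_one, mul_inv_eq_iff_eq_mul]
    ext1 f
    exact Subtype.ext (act_comm (fun e => not_inc_of_notMem hij hF) f.1))

lemma actHom_sym (β : Fin k × Bool) : actHom k F (sym k F β) = actPerm F (bar β) := by
  rcases β with ⟨i, _ | _⟩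
  · simp only [sym, gen, actHom, Bool.false_eq_true, if_false, map_inv, PresentedGroup.toGroup.of]
    rfl
  · simp only [sym, gen, actHom, if_true, PresentedGroup.toGroup.of]
    rfl

/-- The projections of a reduced word for `x`. -/
noncomputable def nf (x : Grp k F) : Proj k :=
  (actHom k F x⁻¹ ⟨fun _ => [], 1, Rep.nil⟩).1

@[simp] lemma nf_one : nf (1 : Grp k F) = fun _ => [] := by simp [nf]

lemma nf_mul_sym (x : Grp k F) (β : Fin k × Bool) :
    nf (x * sym k F β) = act F β (nf x) := by
  simp only [nf, mul_inv_rev, ← sym_bar, map_mul, actHom_sym, bar_bar]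
  rfl

lemma nf_mul_sym_of_hd {x : Grp k F} {β : Fin k × Bool} (h : Hd F (bar β) (nf x)) :
    nf (x * sym k F β) = pop F β.1 (nf x) := by
  rw [nf_mul_sym]; exact if_pos h

lemma nf_mul_sym_of_not_hd {x : Grp k F} {β : Fin k × Bool} (h : ¬ Hd F (bar β) (nf x)) :
    nf (x * sym k F β) = push F β (nf x) := by
  rw [nf_mul_sym]; exact if_neg h

lemma Rep.eq_nf {f : Proj k} {x : Grp k F} (h : Rep f x) : f = nf x := by
  induction h with
  | nil => simp
  | cons γ _ hγ ih =>
    subst ih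
    exact (nf_mul_sym_of_not_hd hγ).symm

lemma induction_mul_sym {P : Grp k F → Prop} (one : P 1)
    (mul : ∀ x β, P x → P (x * sym k F β)) (x : Grp k F) : P x := by
  have hx : x ∈ Subgroup.closure (Set.range (PresentedGroup.of (rels := Rels k F))) := by
    rw [PresentedGroup.closure_range_of]; trivial
  induction hx using Subgroup.closure_induction_right with
  | one => exact one
  | mul_right x _ y hy ih =>
    obtain ⟨i, rfl⟩ := hy
    exact mul x (i, true) ih
  | mul_inv_cancel x _ y hy ih =>
    obtain ⟨i, rfl⟩ := hy
    exact mul x (i, false) ih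

lemma rep_nf (x : Grp k F) : Rep (nf x) x := by
  induction x using induction_mul_sym with
  | one => rw [nf_one]; exact Rep.nil
  | mul x β ih => rw [nf_mul_sym]; exact ih.act β

/-- Induction along a reduced word. -/
lemma induction_reduced {P : Grp k F → Prop} (one : P 1)
    (mul : ∀ x β, ¬ Hd F (bar β) (nf x) → P x → P (x * sym k F β)) (x : Grp k F) : P x := by
  have key : ∀ f : Proj k, Rep f x → P x := by
    intro f h
    induction h with
    | nil => exact one
    | cons γ h hγ ih =>
      have := h.eq_nf
      subst this
      exact mul _ γ hγ ih
  exact key _ (rep_nf x)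

/-- The number of letters recorded by `f`. -/
def size (f : Proj k) : ℕ := ∑ i, (f s(i, i)).length

lemma size_push (β : Fin k × Bool) (f : Proj k) : size (push F β f) = size f + 1 := by
  have : ∀ i, ((push F β f) s(i, i)).length = (f s(i, i)).length + if β.1 = i then 1 else 0 := by
    intro i
    by_cases h : β.1 = i <;> simp [push, inc_diag, h]
  simp [size, this, Finset.sum_add_distrib]

lemma size_pop {β : Fin k × Bool} {f : Proj k} (h : Hd F β f) :
    size (pop F β.1 f) + 1 = size f := by
  rw [← size_push (F := F) β, push_pop h]

lemma size_nf_mul_sym_le (x : Grp k F) (β : Fin k × Bool) :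
    size (nf (x * sym k F β)) ≤ size (nf x) + 1 := by
  by_cases h : Hd F (bar β) (nf x)
  · have h2 := size_pop h
    rw [nf_mul_sym_of_hd h]
    simp only [bar_fst] at h2
    omega
  · rw [nf_mul_sym_of_not_hd h, size_push]

lemma wordProd_append (l l' : List (Fin k × Bool)) :
    wordProd k F (l ++ l') = wordProd k F l * wordProd k F l' := by
  simp [wordProd]

lemma wordProd_concat (l : List (Fin k × Bool)) (β : Fin k × Bool) :
    wordProd k F (l ++ [β]) = wordProd k F l * sym k F β := by
  simp [wordProd]

lemma size_nf_wordProd_le (l : List (Fin k × Bool)) :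
    size (nf (wordProd k F l)) ≤ l.length := by
  induction l using List.reverseRecOn with
  | nil => simp [wordProd, size]
  | append_singleton l β ih =>
    rw [wordProd_concat]
    have := size_nf_mul_sym_le (wordProd k F l) β
    simp only [List.length_append, List.length_singleton]
    omega

lemma exists_word (x : Grp k F) :
    ∃ l, wordProd k F l = x ∧ l.length = size (nf x) := by
  induction x using induction_reduced with
  | one => exact ⟨[], by simp [wordProd], by simp [size]⟩
  | mul x β h ih =>
    obtain ⟨l, rfl, hl⟩ := ih
    exact ⟨l ++ [β], wordProd_concat l β, by
      rw [nf_mul_sym_of_not_hd h, size_push]; simp [hl]⟩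

lemma len_eq_size (x : Grp k F) : len x = size (nf x) := by
  refine le_antisymm (Nat.sInf_le (exists_word x)) ?_
  refine le_csInf ⟨_, exists_word x⟩ ?_
  rintro _ ⟨l, rfl, rfl⟩
  exact size_nf_wordProd_le l

lemma count_eq_of_length_eq (α : Fin k × Bool) (l : List (Fin k × Bool))
    (h : l.length = size (nf (wordProd k F l))) :
    l.count α = (nf (wordProd k F l) s(α.1, α.1)).count α := by
  induction l using List.reverseRecOn with
  | nil => simp [wordProd]
  | append_singleton l β ih =>
    rw [wordProd_concat] at h ⊢
    simp only [List.length_append, List.length_singleton] at h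
    have h1 := size_nf_wordProd_le (F := F) l
    have h2 := size_nf_mul_sym_le (wordProd k F l) β
    have hn : ¬ Hd F (bar β) (nf (wordProd k F l)) := by
      intro hd
      have h3 := size_pop hd
      rw [nf_mul_sym_of_hd hd] at h
      simp only [bar_fst] at h3
      omega
    rw [nf_mul_sym_of_not_hd hn, List.count_append, ih (by omega)]
    by_cases hβ : β.1 = α.1
    · simp [push, inc_diag, hβ, List.count_cons]
    · have : β ≠ α := fun h => hβ (by rw [h])
      simp [push, inc_diag, hβ, this]

lemma symCount_eq (α : Fin k × Bool) (x : Grp k F) :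
    symCount α x = (nf x s(α.1, α.1)).count α := by
  have hex : ∃ l, MinWord x l := by
    obtain ⟨l, h1, h2⟩ := exists_word x
    exact ⟨l, h1, by rw [h2, len_eq_size]⟩
  unfold symCount
  rw [dif_pos hex]
  obtain ⟨h1, h2⟩ := hex.choose_spec
  generalize hex.choose = l at h1 h2
  subst h1
  convert count_eq_of_length_eq α l (by rw [h2, len_eq_size])

lemma exists_minWord (x : Grp k F) : ∃ l, wordProd k F l = x ∧ l.length = len x := by
  simpa [len_eq_size] using exists_word x

lemma len_wordProd_le (l : List (Fin k × Bool)) : len (wordProd k F l) ≤ l.length := by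
  rw [len_eq_size]; exact size_nf_wordProd_le l

lemma len_mul_le (x y : Grp k F) : len (x * y) ≤ len x + len y := by
  obtain ⟨l, rfl, hl⟩ := exists_minWord x
  obtain ⟨l', rfl, hl'⟩ := exists_minWord y
  rw [← wordProd_append, ← hl, ← hl', ← List.length_append]
  exact len_wordProd_le _

lemma wordProd_inv (l : List (Fin k × Bool)) :
    wordProd k F (l.reverse.map bar) = (wordProd k F l)⁻¹ := by
  induction l with
  | nil => simp [wordProd]
  | cons β l ih =>
    rw [List.reverse_cons, List.map_append, List.map_singleton, wordProd_concat, ih, sym_bar]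
    simp [wordProd]

lemma len_inv_le (x : Grp k F) : len x⁻¹ ≤ len x := by
  obtain ⟨l, rfl, hl⟩ := exists_minWord x
  rw [← wordProd_inv, ← hl]
  simpa using len_wordProd_le (F := F) (l.reverse.map bar)

@[simp] lemma len_inv (x : Grp k F) : len x⁻¹ = len x :=
  le_antisymm (len_inv_le x) (by simpa using len_inv_le x⁻¹)

@[simp] lemma len_one : len (1 : Grp k F) = 0 := by simp [len_eq_size, size]

lemma len_mul_sym_of_hd {x : Grp k F} {β : Fin k × Bool} (h : Hd F (bar β) (nf x)) :
    len (x * sym k F β) + 1 = len x := by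
  rw [len_eq_size, len_eq_size, nf_mul_sym_of_hd h]
  exact size_pop (β := bar β) h

lemma len_mul_sym_of_not_hd {x : Grp k F} {β : Fin k × Bool} (h : ¬ Hd F (bar β) (nf x)) :
    len (x * sym k F β) = len x + 1 := by
  rw [len_eq_size, len_eq_size, nf_mul_sym_of_not_hd h, size_push]

lemma len_mul_inv_sym_of_hd {x : Grp k F} {β : Fin k × Bool} (h : Hd F β (nf x)) :
    len (x * (sym k F β)⁻¹) + 1 = len x := by
  rw [← sym_bar]
  exact len_mul_sym_of_hd (by rwa [bar_bar])

lemma len_mul_inv_sym_of_not_hd {x : Grp k F} {β : Fin k × Bool} (h : ¬ Hd F β (nf x)) :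
    len (x * (sym k F β)⁻¹) = len x + 1 := by
  rw [← sym_bar]
  exact len_mul_sym_of_not_hd (by rwa [bar_bar])

lemma not_hd_one (β : Fin k × Bool) : ¬ Hd F β (nf (1 : Grp k F)) := by
  intro h
  simpa using h _ (inc_diag_self _)

lemma nf_sym (β : Fin k × Bool) : nf (sym k F β) = push F β (fun _ => []) := by
  rw [← one_mul (sym k F β), nf_mul_sym_of_not_hd (not_hd_one _), nf_one]

@[simp] lemma len_sym (β : Fin k × Bool) : len (sym k F β) = 1 := by
  rw [← one_mul (sym k F β), len_mul_sym_of_not_hd (not_hd_one _), len_one]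

lemma maxSym_iff {β : Fin k × Bool} {x : Grp k F} : MaxSym β x ↔ Hd F β (nf x) := by
  have : (x * (sym k F β)⁻¹)⁻¹ * x = sym k F β := by group
  unfold MaxSym le
  rw [this, len_sym]
  constructor
  · intro h
    by_contra hn
    have := len_mul_inv_sym_of_not_hd hn
    omega
  · intro h
    exact (len_mul_inv_sym_of_hd h).symm

lemma exists_hd {x : Grp k F} (hx : x ≠ 1) : ∃ β, Hd F β (nf x) := by
  induction x using induction_reduced with
  | one => exact absurd rfl hx
  | mul x β h _ => exact ⟨β, by rw [nf_mul_sym_of_not_hd h]; exact hd_push_self β _⟩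

lemma nf_mul (x y : Grp k F) (h : len (x * y) = len x + len y) (e : Sym2 (Fin k)) :
    nf (x * y) e = nf y e ++ nf x e := by
  induction y using induction_reduced with
  | one => simp
  | mul y β hy ih =>
    rw [len_mul_sym_of_not_hd hy, ← mul_assoc] at h
    rw [← mul_assoc]
    have h1 := len_mul_le x y
    have hn : ¬ Hd F (bar β) (nf (x * y)) := by
      intro hd
      have := len_mul_sym_of_hd hd
      omega
    rw [len_mul_sym_of_not_hd hn] at h
    have := ih (by omega)
    rw [nf_mul_sym_of_not_hd hn, nf_mul_sym_of_not_hd hy]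
    by_cases he : Inc F β.1 e <;> simp [push, he, this]

lemma symCount_mul (α : Fin k × Bool) {x y : Grp k F} (h : len (x * y) = len x + len y) :
    symCount α (x * y) = symCount α x + symCount α y := by
  rw [symCount_eq, symCount_eq, symCount_eq, nf_mul x y h, List.count_append, add_comm]

lemma mem_nf_iff (β : Fin k × Bool) {e : Sym2 (Fin k)} (he : Inc F β.1 e) (x : Grp k F) :
    β ∈ nf x e ↔ β ∈ nf x s(β.1, β.1) := by
  induction x using induction_reduced with
  | one => simp
  | mul x γ h ih =>
    rw [nf_mul_sym_of_not_hd h]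
    by_cases hγ : β = γ
    · subst hγ
      simp [push, he, inc_diag_self]
    · simp only [push]
      split_ifs <;> simp [hγ, ih]

/-- A maximal symbol of a reduced product `x * y` is a maximal symbol of `y`, or a maximal symbol
of `x` whose generator does not occur in `y`. -/
lemma hd_mul {β : Fin k × Bool} {x y : Grp k F} (h : len (x * y) = len x + len y)
    (hβ : Hd F β (nf (x * y))) :
    Hd F β (nf y) ∨ Hd F β (nf x) ∧ nf y s(β.1, β.1) = [] := by
  have hh : ∀ e, Inc F β.1 e → nf y e ≠ [] → (nf y e).head? = some β := by
    intro e he hne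
    have := hβ e he
    rw [nf_mul x y h] at this
    obtain ⟨a, l, hl⟩ := List.exists_cons_of_ne_nil hne
    simpa [hl] using this
  by_cases hy : nf y s(β.1, β.1) = []
  · refine Or.inr ⟨fun e he => ?_, hy⟩
    have hye : nf y e = [] := by
      by_contra hne
      have := (mem_nf_iff β he y).1 (List.mem_of_mem_head? (hh e he hne))
      simp [hy] at this
    have := hβ e he
    rwa [nf_mul x y h, hye, List.nil_append] at this
  · refine Or.inl fun e he => hh e he ?_
    have := (mem_nf_iff β he y).2 (List.mem_of_mem_head? (hh _ (inc_diag_self _) hy))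
    exact List.ne_nil_of_mem this

/-- If the product `x * y⁻¹` is not reduced, then `x` and `y` share a maximal symbol. -/
lemma exists_hd_of_len_lt (x y : Grp k F) (h : len (x * y⁻¹) < len x + len y) :
    ∃ γ, Hd F γ (nf x) ∧ Hd F γ (nf y) := by
  induction y using induction_reduced generalizing x with
  | one => simp at h
  | mul y δ hy ih =>
    by_cases hx : Hd F δ (nf x)
    · exact ⟨δ, hx, by rw [nf_mul_sym_of_not_hd hy]; exact hd_push_self δ _⟩
    · have hx' := len_mul_inv_sym_of_not_hd hx
      rw [mul_inv_rev, ← mul_assoc, len_mul_sym_of_not_hd hy] at h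
      obtain ⟨γ, h1, h2⟩ := ih (x * (sym k F δ)⁻¹) (by omega)
      rw [← sym_bar, nf_mul_sym_of_not_hd (by rwa [bar_bar])] at h1
      rcases hd_push h1 with rfl | ⟨hd, h1'⟩
      · exact absurd h2 hy
      · refine ⟨γ, h1', ?_⟩
        rw [nf_mul_sym_of_not_hd hy]
        exact (hd_push_of_disjoint (γ := δ) hd).2 h2

lemma symCount_sym_of_ne {α β : Fin k × Bool} (h : β.1 ≠ α.1) : symCount α (sym k F β) = 0 := by
  rw [symCount_eq, nf_sym]
  simp [push, inc_diag, h]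

lemma symCount_sym_le (α β : Fin k × Bool) : symCount α (sym k F β) ≤ 1 := by
  rw [symCount_eq, nf_sym]
  by_cases h : β.1 = α.1
  · simpa [push, inc_diag, h] using List.count_le_length (a := α) (l := [β])
  · simp [push, inc_diag, h]

lemma exists_prefix_symCount_eq (α : Fin k × Bool) (x : Grp k F) (n : ℕ) (hn : n ≤ symCount α x) :
    ∃ y z, x = y * z ∧ len x = len y + len z ∧ symCount α y = n := by
  induction x using induction_reduced with
  | one =>
    refine ⟨1, 1, by simp, by simp, ?_⟩
    rw [symCount_eq] at hn ⊢
    simpa [eq_comm] using hn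
  | mul x β h ih =>
    have hl := len_mul_sym_of_not_hd h
    have hc := symCount_mul α (x := x) (y := sym k F β) (by rw [len_sym, hl])
    by_cases hx : n ≤ symCount α x
    · obtain ⟨y, z, rfl, h2, h3⟩ := ih hx
      refine ⟨y, z * sym k F β, mul_assoc _ _ _, ?_, h3⟩
      have h4 := len_mul_le z (sym k F β)
      have h5 := len_mul_le y (z * sym k F β)
      rw [← mul_assoc] at h5
      rw [len_sym] at h4
      omega
    · refine ⟨x * sym k F β, 1, by simp, by simp, ?_⟩
      have := symCount_sym_le (F := F) α β
      omega

/-- Passing from `r' * β` to `r'` in a reduced product `(r' * β) * t`. -/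
lemma conj_sym_reduced {α β : Fin k × Bool} {r' t : Grp k F}
    (hr : len (r' * sym k F β) = len r' + 1)
    (h : len (r' * sym k F β * t) = len (r' * sym k F β) + len t)
    (hβ : β.1 ≠ α.1 ∨ Hd F β (nf (r' * sym k F β * t))) :
    len (r' * (sym k F β * t * (sym k F β)⁻¹)) =
        len r' + len (sym k F β * t * (sym k F β)⁻¹) ∧
      symCount α (sym k F β * t * (sym k F β)⁻¹) = symCount α t := by
  set b := sym k F β with hb
  have e1 : r' * (b * t * b⁻¹) = r' * b * t * b⁻¹ := by group
  have hb1 : len b = 1 := len_sym β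
  have hbi : len b⁻¹ = 1 := by rw [len_inv, hb1]
  have l1 := len_mul_le r' (b * t)
  rw [← mul_assoc] at l1
  have l2 := len_mul_le b t
  have hbt : len (b * t) = len b + len t := by omega
  have l3 := len_mul_le (b * t) b⁻¹
  have l4 := len_mul_le r' (b * t * b⁻¹)
  rw [e1] at l4 ⊢
  have c1 := symCount_mul α hbt
  by_cases hd : Hd F β (nf (r' * b * t))
  · have hd' : Hd F β (nf (b * t)) := by
      have hred : len (r' * (b * t)) = len r' + len (b * t) := by rw [← mul_assoc]; omega
      rcases hd_mul hred (by rwa [← mul_assoc]) with h' | ⟨-, h'⟩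
      · exact h'
      · rw [nf_mul b t hbt, hb, nf_sym] at h'
        simp [push, inc_diag_self] at h'
    have m1 := len_mul_inv_sym_of_hd hd
    have m2 := len_mul_inv_sym_of_hd hd'
    rw [← hb] at m1 m2
    have c2 := symCount_mul α (x := b * t * b⁻¹) (y := b)
      (by rw [inv_mul_cancel_right]; omega)
    rw [inv_mul_cancel_right] at c2
    exact ⟨by omega, by omega⟩
  · have hne := hβ.resolve_right hd
    have m1 := len_mul_inv_sym_of_not_hd hd
    rw [← hb] at m1
    have c2 := symCount_mul α (x := b * t) (y := b⁻¹) (by omega)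
    have c3 : symCount α b = 0 := symCount_sym_of_ne hne
    have c4 : symCount α b⁻¹ = 0 := by
      rw [hb, ← sym_bar]
      exact symCount_sym_of_ne hne
    exact ⟨by omega, by omega⟩

lemma exists_conj_len_le {α : Fin k × Bool} {p : Grp k F} (hp : ∀ β, Hd F β (nf p) → β = α)
    (s t : Grp k F) (hs : len (p * s) = len p + len s)
    (ht : len (p * s * t) = len (p * s) + len t) :
    ∃ t', len (p * t') = len p + len t' ∧ symCount α t' = symCount α t ∧
      len (p * t' * p⁻¹) ≤ len (p * s * t * (p * s)⁻¹) := by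
  induction hn : len s using Nat.strong_induction_on generalizing s t with
  | _ n ih =>
  by_cases hex : ∃ β, Hd F β (nf s) ∧ (β.1 ≠ α.1 ∨ Hd F β (nf (p * s * t)))
  · obtain ⟨β, hβs, hβ⟩ := hex
    set s' := s * (sym k F β)⁻¹ with hs'
    have es : s = s' * sym k F β := by simp [hs']
    have ls := len_mul_inv_sym_of_hd hβs
    rw [← hs'] at ls
    have er : p * s = p * s' * sym k F β := by rw [hs']; group
    have l1 := len_mul_le (p * s') (sym k F β)
    have l2 := len_mul_le p s'
    rw [← er, len_sym] at l1
    rw [er] at ht hβ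
    obtain ⟨h1, h2⟩ := conj_sym_reduced (by rw [← er]; omega) ht hβ
    obtain ⟨t', g1, g2, g3⟩ := ih (len s') (by omega) s' _ (by omega) h1 rfl
    refine ⟨t', g1, g2.trans h2, g3.trans_eq ?_⟩
    rw [er]
    congr 1
    group
  · push Not at hex
    by_cases h1 : s = 1
    · subst h1
      rw [mul_one] at ht ⊢
      exact ⟨t, ht, rfl, le_rfl⟩
    have hfull : len (p * s) + len t + len (p * s) ≤ len (p * s * t * (p * s)⁻¹) := by
      by_contra hlt
      obtain ⟨γ, g1, g2⟩ := exists_hd_of_len_lt (p * s * t) (p * s) (by omega)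
      rcases hd_mul hs g2 with g3 | ⟨g3, g4⟩
      · exact (hex γ g3).2 g1
      · obtain ⟨β, hβ⟩ := exists_hd h1
        have := hβ _ (inc_diag_self _)
        rw [(hex β hβ).1, ← hp γ g3, g4] at this
        simp at this
    have l1 := len_mul_le s t
    have l2 := len_mul_le p (s * t)
    rw [← mul_assoc] at l2
    have hst := symCount_mul α (x := s) (y := t) (by omega)
    obtain ⟨y, z, e, h2, h3⟩ := exists_prefix_symCount_eq α (s * t) (symCount α t) (by omega)
    have l3 := len_mul_le (p * y) z
    have l4 := len_mul_le p y
    have l5 := len_mul_le (p * y) p⁻¹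
    rw [len_inv] at l5
    rw [mul_assoc p y z, ← e, ← mul_assoc] at l3
    exact ⟨y, by omega, h3, by omega⟩

end Heaps

/-- if `p ≤ r ≤ ar` with `p` an `α`-peak, then there is `a'` with
`p ≤ a'p`, `#_α(p⁻¹a'p) = #_α(r⁻¹ar)`, and `|a'| ≤ |a|`. -/
theorem stmt14 {k : ℕ} (hk : 1 ≤ k) {F : Set (Sym2 (Fin k))}
    (α : Fin k × Bool) (p a r : Grp k F)
    (hp : AlphaPeak α p) (h1 : le p r) (h2 : le r (a * r)) :
    ∃ a' : Grp k F, le p (a' * p) ∧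
      symCount α (p⁻¹ * (a' * p)) = symCount α (r⁻¹ * (a * r)) ∧
      len a' ≤ len a := by
  have hs : len (p * (p⁻¹ * r)) = len p + len (p⁻¹ * r) := by
    rw [mul_inv_cancel_left]; exact h1
  have ht : len (p * (p⁻¹ * r) * (r⁻¹ * (a * r))) =
      len (p * (p⁻¹ * r)) + len (r⁻¹ * (a * r)) := by
    rw [mul_inv_cancel_left, mul_inv_cancel_left]; exact h2
  obtain ⟨t, g1, g2, g3⟩ :=
    exists_conj_len_le (fun β hβ => hp.2 β (maxSym_iff.2 hβ)) _ _ hs ht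
  refine ⟨p * t * p⁻¹, ?_, ?_, g3.trans_eq ?_⟩
  · unfold le
    rw [inv_mul_cancel_right, inv_mul_cancel_left]
    exact g1
  · rwa [inv_mul_cancel_right, inv_mul_cancel_left]
  · rw [mul_inv_cancel_left, mul_inv_cancel_left, mul_inv_cancel_right]

end GraphGroupPaper
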